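/- Let r ≥ 2 and ν > 2r+1 be integers with ν odd. Then the Harary graph H_{2r+1,ν} is (2r−1)-factor-critical. -/

import Mathlib

open SimpleGraph

/-- `G` is `n`-factor-critical if for every set `S` of exactly `n` vertices,
the graph obtained by deleting `S` has a perfect matching; formalized as:
there is a matching of `G` whose vertex set is exactly the complement of `S`. -/
def IsFactorCritical {V : Type*} (G : SimpleGraph V) (n : ℕ) : Prop :=
  ∀ S : Finset V, S.card = n →
    ∃ M : G.Subgraph, M.IsMatching ∧ M.verts = (↑S : Set V)ᶜ

/-- `G` is `k`-extendable if it is connected, has a matching with `k` edges,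
and every matching with `k` edges is contained in a perfect matching. -/
def IsExtendable {V : Type*} (G : SimpleGraph V) (k : ℕ) : Prop :=
  G.Connected ∧
  (∃ M : G.Subgraph, M.IsMatching ∧ M.edgeSet.ncard = k) ∧
  ∀ M : G.Subgraph, M.IsMatching → M.edgeSet.ncard = k →
    ∃ P : G.Subgraph, P.IsPerfectMatching ∧ M ≤ P

/-- The Harary graph `H_{2r+1,ν}` for odd `ν`: obtained from the circulant graph
on `ZMod ν` with connection set `{±1, …, ±r}` by adding the edges
`(0,(ν−1)/2)`, `(0,(ν+1)/2)`, and `(i, i+(ν+1)/2)` for `1 ≤ i < (ν−1)/2`. -/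
def hararyOddOdd (r ν : ℕ) : SimpleGraph (ZMod ν) :=
  SimpleGraph.fromRel (fun i j =>
    (∃ t : ℕ, 1 ≤ t ∧ t ≤ r ∧ j = i + (t : ZMod ν)) ∨
    (i = 0 ∧ (j = (((ν - 1) / 2 : ℕ) : ZMod ν) ∨ j = (((ν + 1) / 2 : ℕ) : ZMod ν))) ∨
    (∃ m : ℕ, 1 ≤ m ∧ m < (ν - 1) / 2 ∧ i = (m : ZMod ν) ∧
      j = i + (((ν + 1) / 2 : ℕ) : ZMod ν)))

/-- If the elements of a finite set `T` of naturals of even size are mapped injectively to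
vertices of `G` so that elements at distance at most `r` become adjacent, and every non-maximal
element has a later one at distance at most `r`, then the image of `T` is matched in `G`. -/
lemma exists_isMatching_verts_eq_image {V : Type*} (G : SimpleGraph V) (e : ℕ → V) (r : ℕ)
    (T : Finset ℕ) (heven : Even T.card) (hinj : Set.InjOn e T)
    (hadj : ∀ a ∈ T, ∀ b ∈ T, a < b → b ≤ a + r → G.Adj (e a) (e b))
    (hstep : ∀ a ∈ T, (∃ b ∈ T, a < b) → ∃ b ∈ T, a < b ∧ b ≤ a + r) :
    ∃ M : G.Subgraph, M.IsMatching ∧ M.verts = e '' T := by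
  induction T using Finset.strongInduction with
  | H T ih =>
    obtain rfl | hne := T.eq_empty_or_nonempty
    · exact ⟨⊥, fun v hv => hv.elim, by simp⟩
    let a := T.min' hne
    have ha : a ∈ T := T.min'_mem hne
    have ha_le : ∀ c ∈ T, a ≤ c := fun c hc => T.min'_le c hc
    have hcard : (T.erase a).card = T.card - 1 := Finset.card_erase_of_mem ha
    have hpos : 0 < T.card := hne.card_pos
    have hne' : (T.erase a).Nonempty := by
      rw [← Finset.card_pos]
      obtain ⟨k, hk⟩ := heven
      lia
    let b := (T.erase a).min' hne'
    have hb' : b ∈ T.erase a := (T.erase a).min'_mem hne'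
    have hb_le : ∀ c ∈ T, c ≠ a → b ≤ c := fun c hc hca =>
      (T.erase a).min'_le c (Finset.mem_erase.2 ⟨hca, hc⟩)
    obtain ⟨hba, hb⟩ := Finset.mem_erase.1 hb'
    have hab : a < b := lt_of_le_of_ne (ha_le b hb) (Ne.symm hba)
    have hbr : b ≤ a + r := by
      obtain ⟨c, hc, hac, hcr⟩ := hstep a ha ⟨b, hb, hab⟩
      exact (hb_le c hc hac.ne').trans hcr
    let U := (T.erase a).erase b
    have hUT : ∀ c ∈ U, c ∈ T ∧ c ≠ a ∧ c ≠ b := fun c hc => by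
      simp only [U, Finset.mem_erase] at hc
      exact ⟨hc.2.2, hc.2.1, hc.1⟩
    have hUcard : U.card = T.card - 1 - 1 := by
      rw [← hcard]
      exact Finset.card_erase_of_mem hb'
    obtain ⟨M, hM, hMv⟩ := ih U
      ((Finset.erase_ssubset hb').trans (Finset.erase_ssubset ha))
      (by rw [hUcard]; obtain ⟨k, hk⟩ := heven; exact ⟨k - 1, by lia⟩)
      (hinj.mono fun c hc => (hUT c hc).1)
      (fun c hc d hd => hadj c (hUT c hc).1 d (hUT d hd).1)
      (fun c hc ⟨d, hd, hcd⟩ => by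
        obtain ⟨f, hf, hcf, hfr⟩ := hstep c (hUT c hc).1 ⟨d, (hUT d hd).1, hcd⟩
        have hbc := hb_le c (hUT c hc).1 (hUT c hc).2.1
        refine ⟨f, ?_, hcf, hfr⟩
        simp only [U, Finset.mem_erase]
        exact ⟨by lia, by lia, hf⟩)
    have hG := hadj a ha b hb hab hbr
    refine ⟨M ⊔ G.subgraphOfAdj hG, hM.sup (Subgraph.IsMatching.subgraphOfAdj hG) ?_, ?_⟩
    · rw [hM.support_eq_verts, hMv, support_subgraphOfAdj, Set.disjoint_left]
      rintro _ ⟨c, hc, rfl⟩ hmem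
      obtain ⟨hcT, hca, hcb⟩ := hUT c hc
      rcases hmem with h | h
      · exact hca (hinj hcT ha h)
      · exact hcb (hinj hcT hb h)
    · have hT : T = insert a (insert b U) := by
        rw [Finset.insert_erase hb', Finset.insert_erase ha]
      rw [Subgraph.verts_sup, hMv, subgraphOfAdj_verts, hT]
      push_cast
      rw [Set.image_insert_eq, Set.image_insert_eq]
      ext x
      simp only [Set.mem_union, Set.mem_insert_iff, Set.mem_singleton_iff]
      tauto

/-- Deleting fewer than `2 * r` vertices from the cyclic order on `ZMod ν` leaves at most one
gap of length at least `r`, so some rotation has no such gap before its last element. -/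
lemma exists_rotation_without_large_gap (r ν : ℕ) (S : Finset (ZMod ν))
    (hS : S.card < 2 * r) :
    ∃ s : ZMod ν, ∀ a < ν, s + (a : ZMod ν) ∉ S →
      (∃ b < ν, s + (b : ZMod ν) ∉ S ∧ a < b) →
      ∃ b < ν, s + (b : ZMod ν) ∉ S ∧ a < b ∧ b ≤ a + r := by
  by_cases hgap : ∃ x : ZMod ν, ∀ t : ℕ, 1 ≤ t → t ≤ r → x + (t : ZMod ν) ∈ S
  · obtain ⟨x, hx⟩ := hgap
    refine ⟨x + 1, fun a ha haS ⟨b, hb, hbS, hab⟩ => ?_⟩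
    by_contra! hno
    have hlow : ∀ i < r, x + 1 + (i : ZMod ν) ∈ S := fun i hi => by
      have := hx (i + 1) (by lia) (by lia)
      push_cast at this
      rwa [add_assoc, add_comm 1]
    have har : r ≤ a := by
      by_contra h
      exact haS (hlow a (by lia))
    have hbr : a + r < b := hno b hb hbS hab
    let I := Finset.range r ∪ Finset.Ioc a (a + r)
    have hI : ∀ i ∈ I, i < ν ∧ x + 1 + (i : ZMod ν) ∈ S := fun i hi => by
      simp only [I, Finset.mem_union, Finset.mem_range, Finset.mem_Ioc] at hi
      refine ⟨by lia, ?_⟩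
      rcases hi with hi | hi
      · exact hlow i hi
      · by_contra h
        have := hno i (by lia) h hi.1
        lia
    have hIcard : I.card = 2 * r := by
      rw [Finset.card_union_of_disjoint, Finset.card_range, Nat.card_Ioc]
      · lia
      · rw [Finset.disjoint_left]
        intro i hi hi'
        simp only [Finset.mem_range, Finset.mem_Ioc] at hi hi'
        lia
    have hle : I.card ≤ S.card :=
      Finset.card_le_card_of_injOn (fun i => x + 1 + (i : ZMod ν)) (fun i hi => (hI i hi).2)
        fun i hi j hj hij => CharP.natCast_injOn_Iio (ZMod ν) ν (hI i hi).1 (hI j hj).1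
          (add_left_cancel hij)
    lia
  · push Not at hgap
    refine ⟨0, fun a ha haS ⟨b, hb, hbS, hab⟩ => ?_⟩
    obtain ⟨t, ht, htr, htS⟩ := hgap (0 + (a : ZMod ν))
    by_cases hbt : b ≤ a + r
    · exact ⟨b, hb, hbS, hab, hbt⟩
    · exact ⟨a + t, by lia, by push_cast; rwa [← add_assoc], by lia, by lia⟩

theorem hararyOdd_isFactorCritical_of_odd (r ν : ℕ) (hr : 2 ≤ r) (hν : 2 * r + 1 < ν)
    (hodd : Odd ν) : IsFactorCritical (hararyOddOdd r ν) (2 * r - 1) := by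
  intro S hS
  have : NeZero ν := ⟨by lia⟩
  obtain ⟨s, hs⟩ := exists_rotation_without_large_gap r ν S (by lia)
  let e : ℕ → ZMod ν := fun n => s + (n : ZMod ν)
  have hinj : Set.InjOn e (Set.Iio ν) := fun i hi j hj hij =>
    CharP.natCast_injOn_Iio (ZMod ν) ν hi hj (add_left_cancel hij)
  let T : Finset ℕ := (Finset.range ν).filter fun n => e n ∉ S
  have hT : ∀ n, n ∈ T ↔ n < ν ∧ e n ∉ S := fun n => by simp [T]
  have hinjT : Set.InjOn e T := hinj.mono fun n hn => ((hT n).1 hn).1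
  have himage : T.image e = Sᶜ := by
    ext x
    simp only [Finset.mem_image, Finset.mem_compl, hT]
    constructor
    · rintro ⟨n, hn, rfl⟩
      exact hn.2
    · intro hx
      have hval : e (x - s).val = x := by simp [e]
      exact ⟨(x - s).val, ⟨ZMod.val_lt _, by rwa [hval]⟩, hval⟩
  have hcard : T.card = ν - (2 * r - 1) := by
    rw [← Finset.card_image_of_injOn hinjT, himage, Finset.card_compl, ZMod.card, hS]
  obtain ⟨M, hM, hMv⟩ := exists_isMatching_verts_eq_image (hararyOddOdd r ν) e r T
    (by rw [hcard]; obtain ⟨k, hk⟩ := hodd; exact ⟨k + 1 - r, by lia⟩) hinjT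
    (fun a ha b hb hab hbr => by
      rw [hararyOddOdd, fromRel_adj]
      refine ⟨fun h => hab.ne (hinjT ha hb h), Or.inl (Or.inl ⟨b - a, by lia, by lia, ?_⟩)⟩
      simp only [e]
      rw [Nat.cast_sub hab.le]
      ring)
    (fun a ha ⟨b, hb, hab⟩ => by
      obtain ⟨ha, haS⟩ := (hT a).1 ha
      obtain ⟨hb, hbS⟩ := (hT b).1 hb
      obtain ⟨c, hc, hcS, hac⟩ := hs a ha haS ⟨b, hb, hbS, hab⟩
      exact ⟨c, (hT c).2 ⟨hc, hcS⟩, hac⟩)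
  refine ⟨M, hM, ?_⟩
  rw [hMv, ← Finset.coe_image, himage, Finset.coe_compl]
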